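/- For all a₁ ∈ A₁ and a₂ ∈ A₂ the commutator [χ⁺(a₂), j₁(a₁)] vanishes in C; i.e. the subalgebra χ⁺(A₂) of C commutes elementwise with j₁(A₁). -/

import Mathlib

/-!
Context: `(H, R)` is a quasitriangular Hopf algebra over a field `k`, `H⁺, H⁻` are Hopf
subalgebras with `R ∈ H⁺ ⊗ H⁻`, `A₁` is a right `H⁺`-module algebra, `A₂` a right
`H⁻`-module algebra, `C` is a model of the braided tensor product `A₁ ⊗̲⁺ A₂`,
`f₁ : H⁺ → A₁` is a realization, and `χ⁺ : A₂ → C` is defined by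
`χ⁺(a₂) = Σ j₁(f₁(R⁽¹⁾)) · j₂(a₂ ◁ R⁽²⁾)`.
-/

open TensorProduct

/-- A right module-algebra action of a Hopf algebra `H` on a unital associative
`k`-algebra `A`. -/
structure RightModuleAlgebra (k H A : Type*) [CommRing k] [Ring H] [Ring A]
    [HopfAlgebra k H] [Algebra k A] where
  act : A →ₗ[k] H →ₗ[k] A
  act_mul : ∀ (a : A) (g g' : H), act a (g * g') = act (act a g) g'
  act_one : ∀ a : A, act a 1 = a
  mul_act : ∀ (a a' : A) (g : H),
    act (a * a') g =
      LinearMap.mul' k A (TensorProduct.map (act a) (act a') (Coalgebra.comul (R := k) g))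
  one_act : ∀ g : H, act 1 g = algebraMap k A (Coalgebra.counit (R := k) g)

/-- `Rb ∈ H ⊗ H` is a quasitriangular structure on the Hopf algebra `H`: it is
invertible, `(Δ ⊗ id)(R) = R₁₃R₂₃`, `(id ⊗ Δ)(R) = R₁₃R₁₂`, and
`Δᵒᵖ(h)·R = R·Δ(h)` for all `h ∈ H`. -/
structure IsQuasitriangular (k H : Type*) [CommRing k] [Ring H] [HopfAlgebra k H]
    (Rb : H ⊗[k] H) : Prop where
  isUnit : IsUnit Rb
  comul_id : TensorProduct.map (Coalgebra.comul (R := k)) (LinearMap.id (M := H)) Rb =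
    TensorProduct.map ((TensorProduct.mk k H H).flip 1) LinearMap.id Rb *
      TensorProduct.map (TensorProduct.mk k H H 1) LinearMap.id Rb
  id_comul : TensorProduct.map (LinearMap.id (M := H)) (Coalgebra.comul (R := k)) Rb =
    TensorProduct.map LinearMap.id (TensorProduct.mk k H H 1) Rb *
      TensorProduct.map LinearMap.id ((TensorProduct.mk k H H).flip 1) Rb
  intertwine : ∀ h : H,
    (TensorProduct.comm k H H) (Coalgebra.comul (R := k) h) * Rb =
      Rb * Coalgebra.comul (R := k) h

/-- Hopf subalgebras `H⁺, H⁻` of `H` (presented abstractly as Hopf algebras `Hp, Hm`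
with injective algebra maps into `H` respecting the coalgebra structure), together
with an element `R ∈ H⁺ ⊗ H⁻` whose image in `H ⊗ H` is a quasitriangular structure. -/
structure QTSubData (k H Hp Hm : Type*) [CommRing k] [Ring H] [Ring Hp] [Ring Hm]
    [HopfAlgebra k H] [HopfAlgebra k Hp] [HopfAlgebra k Hm] where
  ip : Hp →ₐ[k] H
  im : Hm →ₐ[k] H
  ip_inj : Function.Injective ip
  im_inj : Function.Injective im
  ip_comul : ∀ g : Hp, Coalgebra.comul (R := k) (ip g) =
    TensorProduct.map ip.toLinearMap ip.toLinearMap (Coalgebra.comul (R := k) g)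
  ip_counit : ∀ g : Hp, Coalgebra.counit (R := k) (ip g) = Coalgebra.counit (R := k) g
  im_comul : ∀ g : Hm, Coalgebra.comul (R := k) (im g) =
    TensorProduct.map im.toLinearMap im.toLinearMap (Coalgebra.comul (R := k) g)
  im_counit : ∀ g : Hm, Coalgebra.counit (R := k) (im g) = Coalgebra.counit (R := k) g
  R : Hp ⊗[k] Hm
  qt : IsQuasitriangular k H (TensorProduct.map ip.toLinearMap im.toLinearMap R)

/-- A model of the braided tensor product `A₁ ⊗̲⁺ A₂`: a unital associative
`k`-algebra `C` with algebra maps `j₁ : A₁ → C`, `j₂ : A₂ → C` such that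
`a₁ ⊗ a₂ ↦ j₁(a₁) j₂(a₂)` is a linear isomorphism `A₁ ⊗ₖ A₂ ≃ C` and
`j₂(a₂) j₁(a₁) = Σ j₁(a₁ ◁ R⁽¹⁾) j₂(a₂ ◁ R⁽²⁾)`. -/
structure BraidedTPModel (k H Hp Hm A₁ A₂ C : Type*) [CommRing k] [Ring H] [Ring Hp]
    [Ring Hm] [Ring A₁] [Ring A₂] [Ring C] [HopfAlgebra k H] [HopfAlgebra k Hp]
    [HopfAlgebra k Hm] [Algebra k A₁] [Algebra k A₂] [Algebra k C]
    (q : QTSubData k H Hp Hm)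
    (ma1 : RightModuleAlgebra k Hp A₁) (ma2 : RightModuleAlgebra k Hm A₂) where
  j₁ : A₁ →ₐ[k] C
  j₂ : A₂ →ₐ[k] C
  mul_bij : Function.Bijective
    ((LinearMap.mul' k C) ∘ₗ (TensorProduct.map j₁.toLinearMap j₂.toLinearMap))
  braid : ∀ (a₁ : A₁) (a₂ : A₂),
    j₂ a₂ * j₁ a₁ =
      LinearMap.mul' k C
        (TensorProduct.map (j₁.toLinearMap ∘ₗ ma1.act a₁)
          (j₂.toLinearMap ∘ₗ ma2.act a₂) q.R)

/-- A realization of `H` in `A`: an algebra homomorphism `f : H → A` such that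
`a · f(g) = Σ f(g₍₁₎) · (a ◁ g₍₂₎)` for all `a ∈ A`, `g ∈ H`. -/
def IsRealization {k H A : Type*} [CommRing k] [Ring H] [Ring A]
    [HopfAlgebra k H] [Algebra k A]
    (ma : RightModuleAlgebra k H A) (f : H →ₐ[k] A) : Prop :=
  ∀ (a : A) (g : H),
    a * f g =
      LinearMap.mul' k A
        (TensorProduct.map f.toLinearMap (ma.act a) (Coalgebra.comul (R := k) g))

variable {k H Hp Hm A₁ A₂ C : Type*} [CommRing k] [Ring H] [Ring Hp]
  [Ring Hm] [Ring A₁] [Ring A₂] [Ring C] [HopfAlgebra k H] [HopfAlgebra k Hp]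
  [HopfAlgebra k Hm] [Algebra k A₁] [Algebra k A₂] [Algebra k C]
  {q : QTSubData k H Hp Hm}
  {ma1 : RightModuleAlgebra k Hp A₁} {ma2 : RightModuleAlgebra k Hm A₂}

/-- The unbraiding map `χ⁺ : A₂ → C`, `χ⁺(a₂) = Σ j₁(f₁(R⁽¹⁾)) · j₂(a₂ ◁ R⁽²⁾)`
(a `k`-linear map). -/
noncomputable def chiPlus (btp : BraidedTPModel k H Hp Hm A₁ A₂ C q ma1 ma2)
    (f₁ : Hp →ₐ[k] A₁) : A₂ →ₗ[k] C where
  toFun a₂ :=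
    LinearMap.mul' k C
      (TensorProduct.map (btp.j₁.toLinearMap ∘ₗ f₁.toLinearMap)
        (btp.j₂.toLinearMap ∘ₗ ma2.act a₂) q.R)
  map_add' a b := by
    simp only [map_add, LinearMap.comp_add, TensorProduct.map_add_right, LinearMap.add_apply]
  map_smul' c a := by
    simp only [map_smul, LinearMap.comp_smul, TensorProduct.map_smul_right,
      LinearMap.smul_apply, RingHom.id_apply]

/-- The relation `(Δ ⊗ id)(R) = R₁₃R₂₃` already holds in `H⁺ ⊗ H⁺ ⊗ H⁻`. -/
theorem QTSubData.comul_id {k H Hp Hm : Type*} [Field k] [Ring H] [Ring Hp] [Ring Hm]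
    [HopfAlgebra k H] [HopfAlgebra k Hp] [HopfAlgebra k Hm] (q : QTSubData k H Hp Hm) :
    TensorProduct.map (Coalgebra.comul (R := k)) (LinearMap.id (M := Hm)) q.R =
      TensorProduct.map ((TensorProduct.mk k Hp Hp).flip 1) LinearMap.id q.R *
        TensorProduct.map (TensorProduct.mk k Hp Hp 1) LinearMap.id q.R := by
  let Φ := Algebra.TensorProduct.map (Algebra.TensorProduct.map q.ip q.ip) q.im
  have hΦ : Function.Injective Φ :=
    TensorProduct.map_injective_of_flat_flat _ _
      (TensorProduct.map_injective_of_flat_flat _ _ q.ip_inj q.ip_inj) q.im_inj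
  have hcomul (x : Hp ⊗[k] Hm) :
      Φ (TensorProduct.map (Coalgebra.comul (R := k)) LinearMap.id x) =
        TensorProduct.map (Coalgebra.comul (R := k)) LinearMap.id
          (TensorProduct.map q.ip.toLinearMap q.im.toLinearMap x) := by
    induction x with
    | zero => simp only [map_zero]
    | add x y hx hy => simp only [map_add, hx, hy]
    | tmul g h =>
      simp only [TensorProduct.map_tmul, AlgHom.toLinearMap_apply, q.ip_comul]
      rfl
  have hleft (x : Hp ⊗[k] Hm) :
      Φ (TensorProduct.map ((TensorProduct.mk k Hp Hp).flip 1) LinearMap.id x) =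
        TensorProduct.map ((TensorProduct.mk k H H).flip 1) LinearMap.id
          (TensorProduct.map q.ip.toLinearMap q.im.toLinearMap x) := by
    induction x with
    | zero => simp only [map_zero]
    | add x y hx hy => simp only [map_add, hx, hy]
    | tmul g h => simp [Φ]
  have hright (x : Hp ⊗[k] Hm) :
      Φ (TensorProduct.map (TensorProduct.mk k Hp Hp 1) LinearMap.id x) =
        TensorProduct.map (TensorProduct.mk k H H 1) LinearMap.id
          (TensorProduct.map q.ip.toLinearMap q.im.toLinearMap x) := by
    induction x with
    | zero => simp only [map_zero]
    | add x y hx hy => simp only [map_add, hx, hy]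
    | tmul g h => simp [Φ]
  apply hΦ
  rw [map_mul, hcomul, hleft, hright, q.qt.comul_id]

/-- The map `g ⊗ g' ⊗ h ↦ j₁(f₁(g) (a₁ ◁ g')) j₂(a₂ ◁ h)`. -/
noncomputable def BraidedTPModel.realizedMul
    (btp : BraidedTPModel k H Hp Hm A₁ A₂ C q ma1 ma2) (f₁ : Hp →ₐ[k] A₁) (a₁ : A₁) (a₂ : A₂) :
    (Hp ⊗[k] Hp) ⊗[k] Hm →ₗ[k] C :=
  LinearMap.mul' k C ∘ₗ TensorProduct.map
    (btp.j₁.toLinearMap ∘ₗ LinearMap.mul' k A₁ ∘ₗ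
      TensorProduct.map f₁.toLinearMap (ma1.act a₁))
    (btp.j₂.toLinearMap ∘ₗ ma2.act a₂)

theorem BraidedTPModel.j₁_mul_chiPlus
    (btp : BraidedTPModel k H Hp Hm A₁ A₂ C q ma1 ma2) {f₁ : Hp →ₐ[k] A₁}
    (hf₁ : IsRealization ma1 f₁) (a₁ : A₁) (a₂ : A₂) :
    btp.j₁ a₁ * chiPlus btp f₁ a₂ =
      btp.realizedMul f₁ a₁ a₂
        (TensorProduct.map (Coalgebra.comul (R := k)) LinearMap.id q.R) := by
  change btp.j₁ a₁ * LinearMap.mul' k C (TensorProduct.map _ _ q.R) = _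
  induction q.R with
  | zero => simp only [map_zero, mul_zero]
  | add x y hx hy => simp only [map_add, mul_add, hx, hy]
  | tmul g h =>
    simp only [BraidedTPModel.realizedMul, TensorProduct.map_tmul, LinearMap.comp_apply,
      LinearMap.mul'_apply, AlgHom.toLinearMap_apply, LinearMap.id_apply, ← hf₁ a₁ g, map_mul,
      mul_assoc]

theorem BraidedTPModel.chiPlus_mul_j₁
    (btp : BraidedTPModel k H Hp Hm A₁ A₂ C q ma1 ma2) (f₁ : Hp →ₐ[k] A₁) (a₁ : A₁) (a₂ : A₂) :
    chiPlus btp f₁ a₂ * btp.j₁ a₁ =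
      btp.realizedMul f₁ a₁ a₂
        (TensorProduct.map ((TensorProduct.mk k Hp Hp).flip 1) LinearMap.id q.R *
          TensorProduct.map (TensorProduct.mk k Hp Hp 1) LinearMap.id q.R) := by
  have hbraid (g : Hp) (h : Hm) (y : Hp ⊗[k] Hm) :
      btp.j₁ (f₁ g) * LinearMap.mul' k C
        (TensorProduct.map (btp.j₁.toLinearMap ∘ₗ ma1.act a₁)
          (btp.j₂.toLinearMap ∘ₗ ma2.act (ma2.act a₂ h)) y) =
      btp.realizedMul f₁ a₁ a₂
        (((g ⊗ₜ[k] (1 : Hp)) ⊗ₜ[k] h) *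
          TensorProduct.map (TensorProduct.mk k Hp Hp 1) LinearMap.id y) := by
    induction y with
    | zero => simp only [map_zero, mul_zero]
    | add x y hx hy => simp only [map_add, mul_add, hx, hy]
    | tmul g' h' =>
      simp [BraidedTPModel.realizedMul, ma2.act_mul, mul_assoc]
  have hsum (x : Hp ⊗[k] Hm) :
      LinearMap.mul' k C
          (TensorProduct.map (btp.j₁.toLinearMap ∘ₗ f₁.toLinearMap)
            (btp.j₂.toLinearMap ∘ₗ ma2.act a₂) x) * btp.j₁ a₁ =
        btp.realizedMul f₁ a₁ a₂
          (TensorProduct.map ((TensorProduct.mk k Hp Hp).flip 1) LinearMap.id x *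
            TensorProduct.map (TensorProduct.mk k Hp Hp 1) LinearMap.id q.R) := by
    induction x with
    | zero => simp only [map_zero, zero_mul]
    | add x y hx hy => simp only [map_add, add_mul, hx, hy]
    | tmul g h =>
      simp only [TensorProduct.map_tmul, LinearMap.comp_apply, LinearMap.mul'_apply,
        AlgHom.toLinearMap_apply, LinearMap.id_apply, LinearMap.flip_apply,
        TensorProduct.mk_apply, mul_assoc, btp.braid, hbraid]
  exact hsum q.R

/-- for all `a₁ ∈ A₁`, `a₂ ∈ A₂` the commutator `[χ⁺(a₂), j₁(a₁)]`
vanishes in `C`: the subalgebra `χ⁺(A₂)` commutes elementwise with `j₁(A₁)`. -/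
theorem chiPlus_commutes {k H Hp Hm A₁ A₂ C : Type*} [Field k] [Ring H] [Ring Hp]
    [Ring Hm] [Ring A₁] [Ring A₂] [Ring C] [HopfAlgebra k H] [HopfAlgebra k Hp]
    [HopfAlgebra k Hm] [Algebra k A₁] [Algebra k A₂] [Algebra k C]
    (q : QTSubData k H Hp Hm)
    (ma1 : RightModuleAlgebra k Hp A₁) (ma2 : RightModuleAlgebra k Hm A₂)
    (btp : BraidedTPModel k H Hp Hm A₁ A₂ C q ma1 ma2)
    (f₁ : Hp →ₐ[k] A₁) (hf₁ : IsRealization ma1 f₁) :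
    ∀ (a₁ : A₁) (a₂ : A₂),
      chiPlus btp f₁ a₂ * btp.j₁ a₁ = btp.j₁ a₁ * chiPlus btp f₁ a₂ := by
  intro a₁ a₂
  rw [btp.chiPlus_mul_j₁, btp.j₁_mul_chiPlus hf₁, q.comul_id]
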